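/- Let n ≥ 1 and m ≥ 2 be integers. Then for every p ∈ [0,1], Pr[Y*_{n,m−1} > p and X_{(1),n} < p] = n·(1 − p)·Σ_{i=0}^{m−2} p^{n+i}/(n+i); equivalently, Pr[Y*_{n,m−1} > p | X_{(1),n} < p] = n·(1 − p)·Σ_{i=0}^{m−2} p^{i}/(n+i) = 1 − n·p^{m−1}/(n+m−2) − Σ_{i=1}^{m−2} n·p^{i}/((n+i)(n+i−1)). -/

import Mathlib

open MeasureTheory Set

/-- The uniform distribution on `[0,1]`. -/
noncomputable def unif : Measure ℝ := volume.restrict (Set.Icc 0 1)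

instance : IsProbabilityMeasure unif := by
  constructor
  simp [unif, Real.volume_Icc]

/-- The `k`-th largest entry (1-indexed) of a tuple `x : Fin n → ℝ`. -/
noncomputable def kthLargest {n : ℕ} (x : Fin n → ℝ) (k : ℕ) : ℝ :=
  if h : n - k < n then x (Tuple.sort x ⟨n - k, h⟩) else 0

open Classical in
/-- Using an auxiliary uniform `v ∈ [0,1]` as randomness, pick (uniformly at random when `v`
is uniform) the value `y j` for an index `j` in the set `{j | t < y j}`.  Returns `0` if
that set is empty. -/
noncomputable def pickedY {k : ℕ} (y : Fin k → ℝ) (t v : ℝ) : ℝ :=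
  let S : Finset (Fin k) := Finset.univ.filter (fun j => t < y j)
  ((S.sort (· ≤ ·)).map y).getD (min (Int.toNat ⌊v * S.card⌋) (S.card - 1)) 0

open Classical in
/-- The random variable `Y*_{n,m-1}`: it equals `0` if `Y_j < X_{(1),n}` for all `j`, and
otherwise equals `Y_J` where `J` is uniform on `{j | Y_j > X_{(1),n}}` (chosen using the
auxiliary independent uniform `v`). -/
noncomputable def Ystar {n k : ℕ} (x : Fin n → ℝ) (y : Fin k → ℝ) (v : ℝ) : ℝ :=
  if ∀ j, y j < kthLargest x 1 then 0 else pickedY y (kthLargest x 1) v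

/-- The sample space: `n` i.i.d. uniforms `X`, `m-1` i.i.d. uniforms `Y`, and the auxiliary
uniform used to choose `J`, all independent. -/
noncomputable def P₈ (n m : ℕ) : Measure ((Fin n → ℝ) × (Fin (m - 1) → ℝ) × ℝ) :=
  (Measure.pi fun _ : Fin n => unif).prod
    ((Measure.pi fun _ : Fin (m - 1) => unif).prod unif)


lemma kth_le {n : ℕ} (hn : 1 ≤ n) (x : Fin n → ℝ) (a : ℝ) :
    kthLargest x 1 ≤ a ↔ ∀ i, x i ≤ a := by
  have h : n - 1 < n := by omega
  unfold kthLargest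
  rw [dif_pos h]
  constructor
  · intro hx i
    refine le_trans ?_ hx
    have := Tuple.monotone_sort x (a := (Tuple.sort x).symm i) (b := ⟨n - 1, h⟩)
      (by rw [Fin.le_def]; simp; have := ((Tuple.sort x).symm i).2; omega)
    simpa using this
  · intro hx
    exact hx _

lemma kth_meas {n : ℕ} (hn : 1 ≤ n) : Measurable (fun x : Fin n → ℝ => kthLargest x 1) := by
  apply measurable_of_Iic
  intro a
  have : (fun x : Fin n → ℝ => kthLargest x 1) ⁻¹' Set.Iic a = Set.univ.pi (fun _ => Set.Iic a) := by
    ext x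
    simp only [Set.mem_preimage, Set.mem_Iic, kth_le hn, Set.mem_pi, Set.mem_univ, true_imp_iff]
  rw [this]
  exact MeasurableSet.univ_pi (fun _ => measurableSet_Iic)

lemma unif_Iic (a : ℝ) : unif (Set.Iic a) = ENNReal.ofReal (max 0 (min a 1)) := by
  unfold unif
  rw [Measure.restrict_apply measurableSet_Iic]
  have : Set.Iic a ∩ Set.Icc 0 1 = Set.Icc 0 (min a 1) := by
    ext t; simp; tauto
  rw [this, Real.volume_Icc]
  rw [sub_zero]
  rcases le_total 0 (min a 1) with h | h
  · rw [max_eq_right h]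
  · rw [max_eq_left h, ENNReal.ofReal_of_nonpos h]; simp

lemma unif_Ioi {a : ℝ} (h0 : 0 ≤ a) (h1 : a ≤ 1) : unif (Set.Ioi a) = ENNReal.ofReal (1 - a) := by
  unfold unif
  rw [Measure.restrict_apply measurableSet_Ioi]
  have : Set.Ioi a ∩ Set.Icc 0 1 = Set.Ioc a 1 := by
    ext t; simp only [Set.mem_inter_iff, Set.mem_Ioi, Set.mem_Icc, Set.mem_Ioc]; constructor
    · tauto
    · rintro ⟨h, h'⟩; exact ⟨h, by linarith, h'⟩
  rw [this, Real.volume_Ioc]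

lemma lint_pow (c b : ℝ) (hc : 0 ≤ c) (hb : 0 ≤ b) (j : ℕ) :
    ∫⁻ t in Set.Ioc 0 b, ENNReal.ofReal (c * t ^ j) = ENNReal.ofReal (c * b ^ (j + 1) / (j + 1)) := by
  rw [← ofReal_integral_eq_lintegral_ofReal]
  · rw [← intervalIntegral.integral_of_le hb, intervalIntegral.integral_const_mul, integral_pow]
    congr 1
    simp
    ring
  · have : IntervalIntegrable (fun t : ℝ => c * t ^ j) volume 0 b :=
      (by fun_prop : Continuous (fun t : ℝ => c * t ^ j)).intervalIntegrable _ _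
    exact (intervalIntegrable_iff_integrableOn_Ioc_of_le hb).1 this
  · rw [Filter.EventuallyLE, ae_restrict_iff' measurableSet_Ioc]
    refine Filter.Eventually.of_forall fun t ht => ?_
    have := ht.1.le
    simp only [Pi.zero_apply]
    positivity

lemma max_law {n : ℕ} (hn : 1 ≤ n) :
    (Measure.pi fun _ : Fin n => unif).map (fun x => kthLargest x 1) =
      (volume.restrict (Set.Ioc 0 1)).withDensity (fun t => ENNReal.ofReal (n * t ^ (n - 1))) := by
  have : IsProbabilityMeasure ((Measure.pi fun _ : Fin n => unif).map (fun x => kthLargest x 1)) :=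
    Measure.isProbabilityMeasure_map (kth_meas hn).aemeasurable
  apply Measure.ext_of_Iic
  intro a
  rw [Measure.map_apply (kth_meas hn) measurableSet_Iic]
  have h1 : (fun x : Fin n → ℝ => kthLargest x 1) ⁻¹' Set.Iic a = Set.univ.pi (fun _ => Set.Iic a) := by
    ext x
    simp only [Set.mem_preimage, Set.mem_Iic, kth_le hn, Set.mem_pi, Set.mem_univ, true_imp_iff]
  rw [h1, Measure.pi_pi, withDensity_apply _ measurableSet_Iic,
    Measure.restrict_restrict measurableSet_Iic]
  have h2 : Set.Iic a ∩ Set.Ioc 0 1 = Set.Ioc 0 (max 0 (min a 1)) := by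
    ext t
    simp only [Set.mem_inter_iff, Set.mem_Iic, Set.mem_Ioc, le_max_iff, le_min_iff]
    constructor
    · tauto
    · rintro ⟨h, h' | h'⟩
      · linarith
      · tauto
  rw [h2, lint_pow _ _ (by positivity) (le_max_left _ _)]
  simp only [unif_Iic, Finset.prod_const, Finset.card_univ, Fintype.card_fin]
  rw [← ENNReal.ofReal_pow (le_max_left _ _)]
  congr 1
  obtain ⟨k, rfl⟩ : ∃ k, n = k + 1 := ⟨n - 1, by omega⟩
  have : (k : ℝ) + 1 ≠ 0 := by positivity
  simp only [Nat.add_sub_cancel]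
  push_cast
  field_simp

open Classical in
lemma unif_idx (s : ℕ) (hs : 0 < s) (Q : ℕ → Prop) :
    unif {v | Q (min (Int.toNat ⌊v * s⌋) (s - 1))} =
      ∑ i ∈ Finset.range s, if Q i then (s : ENNReal)⁻¹ else 0 := by
  have hs' : (0 : ℝ) < s := by exact_mod_cast hs
  have key : ∀ v : ℝ, 0 ≤ v → v < 1 → ∀ i : ℕ, 
      (min (Int.toNat ⌊v * s⌋) (s - 1) = i ↔ v ∈ Set.Ico ((i : ℝ) / s) ((i + 1 : ℝ) / s)) := by
    intro v h0 h1 i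
    have e : Int.toNat ⌊v * s⌋ = ⌊v * s⌋₊ := rfl
    have hlt : ⌊v * s⌋₊ < s := by
      rw [Nat.floor_lt (by positivity)]
      nlinarith
    rw [e, min_eq_left (by omega), Nat.floor_eq_iff (by positivity), Set.mem_Ico, div_le_iff₀ hs',
      lt_div_iff₀ hs']
  have hae : {v : ℝ | Q (min (Int.toNat ⌊v * s⌋) (s - 1))} =ᵐ[unif]
      ⋃ i ∈ (Finset.range s).filter Q, Set.Ico ((i : ℝ) / s) ((i + 1 : ℝ) / s) := by
    have h1 : ∀ᵐ v ∂unif, v ≠ 1 := by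
      unfold unif
      exact ae_restrict_of_ae (by simp [ae_iff])
    have h2 : ∀ᵐ v ∂unif, v ∈ Set.Icc (0 : ℝ) 1 := ae_restrict_mem measurableSet_Icc
    filter_upwards [h1, h2] with v hv1 hv2
    have hv : v < 1 := lt_of_le_of_ne hv2.2 hv1
    apply propext
    change Q _ ↔ v ∈ (⋃ i ∈ (Finset.range s).filter Q, Set.Ico ((i : ℝ) / s) ((i + 1 : ℝ) / s))
    simp only [Set.mem_iUnion, ← key v hv2.1 hv, Finset.mem_filter, Finset.mem_range, exists_prop]
    constructor
    · intro h
      exact ⟨_, ⟨by omega, h⟩, rfl⟩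
    · rintro ⟨i, ⟨_, h⟩, h'⟩
      rwa [h']
  rw [measure_congr hae, measure_biUnion_finset, ← Finset.sum_filter]
  · apply Finset.sum_congr rfl
    intro i hi
    have hi' : i + 1 ≤ s := by simp at hi; omega
    have hi'' : (i : ℝ) + 1 ≤ s := by exact_mod_cast hi'
    unfold unif
    rw [Measure.restrict_apply measurableSet_Ico, Set.inter_eq_left.2, Real.volume_Ico]
    · rw [← sub_div, add_sub_cancel_left, one_div, ENNReal.ofReal_inv_of_pos hs',
        ENNReal.ofReal_natCast]
    · intro v hv
      refine ⟨le_trans (by positivity) hv.1, hv.2.le.trans ?_⟩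
      rw [div_le_one hs']
      exact hi''
  · intro i _ j _ hij
    rw [Function.onFun, Set.disjoint_left]
    intro v hv hv'
    rw [Set.mem_Ico, div_le_iff₀ hs', lt_div_iff₀ hs'] at hv hv'
    apply hij
    have a1 : (i : ℝ) < j + 1 := by linarith
    have a2 : (j : ℝ) < i + 1 := by linarith
    have b1 : i < j + 1 := by exact_mod_cast a1
    have b2 : j < i + 1 := by exact_mod_cast a2
    omega
  · intro i _
    exact measurableSet_Ico

lemma list_sum_getD (l : List ℝ) (f : ℝ → ENNReal) :
    ∑ i ∈ Finset.range l.length, f (l.getD i 0) = (l.map f).sum := by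
  induction l with
  | nil => simp
  | cons a l ih =>
    rw [List.length_cons, Finset.sum_range_succ']
    simp only [List.getD_cons_succ, List.getD_cons_zero, List.map_cons, List.sum_cons]
    rw [ih, add_comm]

/-- Number of entries exceeding `t`. -/
noncomputable def cnt {k : ℕ} (t : ℝ) (y : Fin k → ℝ) : ENNReal :=
  ∑ j, (Set.Ioi t).indicator 1 (y j)

open Classical in
lemma cnt_eq_card {k : ℕ} (t : ℝ) (y : Fin k → ℝ) :
    cnt t y = ((Finset.univ.filter (fun j => t < y j)).card : ENNReal) := by
  simp [cnt, Set.indicator_apply, Finset.sum_ite]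

open Classical in
lemma unif_picked {k : ℕ} (y : Fin k → ℝ) {t p : ℝ} (hp : 0 ≤ p) (htp : t < p) :
    unif {v | p < pickedY y t v} = cnt p y * (cnt t y)⁻¹ := by
  unfold pickedY
  rw [cnt_eq_card t]
  set S : Finset (Fin k) := Finset.univ.filter (fun j => t < y j) with hS
  rcases Nat.eq_zero_or_pos S.card with h0 | hpos
  · have hSe : S = ∅ := Finset.card_eq_zero.1 h0
    have h1 : cnt p y = 0 := by
      rw [cnt_eq_card]
      have : Finset.univ.filter (fun j => p < y j) = ∅ := by
        rw [Finset.eq_empty_iff_forall_notMem]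
        intro j hj
        have : j ∈ S := by
          simp [hS] at hj ⊢
          linarith
        simp [hSe] at this
      simp [this]
    rw [h1, zero_mul]
    simp [hSe, not_lt.2 hp]
  · simp only
    have := unif_idx S.card hpos (fun i => p < ((S.sort (· ≤ ·)).map y).getD i 0)
    rw [this]
    have hl : S.card = ((S.sort (· ≤ ·)).map y).length := by simp
    have h2 := list_sum_getD ((S.sort (· ≤ ·)).map y)
      (fun z => if p < z then (S.card : ENNReal)⁻¹ else 0)
    rw [← hl] at h2
    rw [h2, List.map_map]
    have h3 := List.sum_toFinset ((fun z => if p < z then (S.card : ENNReal)⁻¹ else 0) ∘ y)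
      (Finset.sort_nodup S (· ≤ ·))
    rw [← h3, Finset.sort_toFinset, cnt, Finset.sum_mul]
    rw [← Finset.sum_subset (Finset.subset_univ S)]
    · apply Finset.sum_congr rfl
      intro j _
      simp [Set.indicator_apply]
    · intro j _ hj
      have : ¬ p < y j := by
        intro h
        apply hj
        simp [hS]
        linarith
      simp [Set.indicator_apply, this]

lemma cnt_meas {k : ℕ} (t : ℝ) : Measurable (fun y : Fin k → ℝ => cnt t y) := by
  unfold cnt
  refine Finset.measurable_sum _ fun j _ => ?_
  exact (measurable_one.indicator measurableSet_Ioi).comp (measurable_pi_apply j)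

lemma one_term {k : ℕ} (j : Fin (k + 1)) {t q : ℝ} (h0 : 0 ≤ t) (htq : t ≤ q) (hq : q ≤ 1) :
    ∫⁻ y, (Set.Ioi q).indicator 1 (y j) * (cnt t y)⁻¹ ∂(Measure.pi fun _ : Fin (k + 1) => unif) =
      ENNReal.ofReal (1 - q) *
        ∫⁻ y, (1 + cnt t y)⁻¹ ∂(Measure.pi fun _ : Fin k => unif) := by
  have mp := measurePreserving_piFinSuccAbove (fun _ : Fin (k + 1) => unif) j
  have hm1 : Measurable ((Set.Ioi q).indicator (1 : ℝ → ENNReal)) :=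
    measurable_one.indicator measurableSet_Ioi
  have hm2 : Measurable (fun y : Fin k → ℝ => (1 + cnt t y)⁻¹) :=
    (measurable_const.add (cnt_meas t)).inv
  have h1 := mp.lintegral_comp (f := fun z : ℝ × (Fin k → ℝ) =>
    (Set.Ioi q).indicator 1 z.1 * (1 + cnt t z.2)⁻¹)
    ((hm1.comp measurable_fst).mul (hm2.comp measurable_snd))
  rw [lintegral_prod_mul hm1.aemeasurable hm2.aemeasurable, lintegral_indicator_one measurableSet_Ioi,
    unif_Ioi (h0.trans htq) hq] at h1
  rw [← h1]
  apply lintegral_congr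
  intro y
  simp only [MeasurableEquiv.piFinSuccAbove_apply, Fin.insertNthEquiv_symm_apply, Fin.removeNth]
  by_cases h : q < y j
  · have : cnt t y = 1 + cnt t (fun i => y (j.succAbove i)) := by
      unfold cnt
      rw [Fin.sum_univ_succAbove _ j]
      simp [Set.indicator_apply, lt_of_le_of_lt htq h]
    rw [this]
    rfl
  · simp [Set.indicator_apply, h]

lemma A_eq {k : ℕ} {t q : ℝ} (h0 : 0 ≤ t) (htq : t ≤ q) (hq : q ≤ 1) :
    ∫⁻ y, cnt q y * (cnt t y)⁻¹ ∂(Measure.pi fun _ : Fin (k + 1) => unif) =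
      ENNReal.ofReal (1 - q) * ((k + 1 : ℕ) *
        ∫⁻ y, (1 + cnt t y)⁻¹ ∂(Measure.pi fun _ : Fin k => unif)) := by
  have : ∀ y : Fin (k + 1) → ℝ, cnt q y * (cnt t y)⁻¹ =
      ∑ j, (Set.Ioi q).indicator 1 (y j) * (cnt t y)⁻¹ := by
    intro y
    rw [cnt, Finset.sum_mul]
  simp_rw [this]
  rw [lintegral_finsetSum]
  · simp_rw [one_term _ h0 htq hq]
    simp
    ring
  · intro j _
    exact ((measurable_one.indicator measurableSet_Ioi).comp (measurable_pi_apply j)).mul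
      (cnt_meas t).inv

lemma A_t {k : ℕ} {t : ℝ} (h0 : 0 ≤ t) (h1 : t ≤ 1) :
    ∫⁻ y, cnt t y * (cnt t y)⁻¹ ∂(Measure.pi fun _ : Fin (k + 1) => unif) =
      ENNReal.ofReal (1 - t ^ (k + 1)) := by
  classical
  have hms : MeasurableSet (Set.univ.pi (fun _ : Fin (k + 1) => Set.Iic t)) :=
    MeasurableSet.univ_pi (fun _ => measurableSet_Iic)
  have : ∀ y : Fin (k + 1) → ℝ, cnt t y * (cnt t y)⁻¹ =
      (Set.univ.pi (fun _ : Fin (k + 1) => Set.Iic t))ᶜ.indicator 1 y := by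
    intro y
    have hiff : y ∈ (Set.univ.pi (fun _ : Fin (k + 1) => Set.Iic t))ᶜ ↔ cnt t y ≠ 0 := by
      rw [Set.mem_compl_iff, not_iff_not, cnt_eq_card]
      simp only [Set.mem_pi, Set.mem_univ, true_imp_iff, Set.mem_Iic, Nat.cast_eq_zero,
        Finset.card_eq_zero, Finset.filter_eq_empty_iff, Finset.mem_univ, not_lt]
    by_cases h : cnt t y = 0
    · rw [Set.indicator_of_notMem (by rw [hiff]; simpa using h), h, zero_mul]
    · rw [Set.indicator_of_mem (hiff.2 h), ENNReal.mul_inv_cancel h]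
      · rfl
      · rw [cnt_eq_card]; simp
  simp_rw [this]
  rw [lintegral_indicator_one hms.compl, prob_compl_eq_one_sub hms, Measure.pi_pi]
  simp only [unif_Iic, Finset.prod_const, Finset.card_univ, Fintype.card_fin]
  rw [min_eq_left h1, max_eq_right h0, ← ENNReal.ofReal_pow h0,
    ENNReal.ofReal_sub _ (by positivity), ENNReal.ofReal_one]

lemma A_p {k : ℕ} {t p : ℝ} (h0 : 0 ≤ t) (htp : t < p) (hp : p ≤ 1) :
    ∫⁻ y, cnt p y * (cnt t y)⁻¹ ∂(Measure.pi fun _ : Fin (k + 1) => unif) =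
      ENNReal.ofReal ((1 - p) * ∑ i ∈ Finset.range (k + 1), t ^ i) := by
  have e1 := A_eq (k := k) h0 htp.le hp
  have e2 := A_eq (k := k) h0 le_rfl (htp.le.trans hp)
  rw [A_t h0 (htp.le.trans hp)] at e2
  rw [e1, ENNReal.ofReal_mul (by linarith)]
  congr 1
  have hg : 1 - t ^ (k + 1) = (1 - t) * ∑ i ∈ Finset.range (k + 1), t ^ i := by
    have := geom_sum_mul t (k + 1)
    linarith
  rw [hg, ENNReal.ofReal_mul (by linarith)] at e2
  refine ((ENNReal.mul_right_inj ?_ ENNReal.ofReal_ne_top).1 e2).symm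
  rw [Ne, ENNReal.ofReal_eq_zero]
  linarith

open Classical in
lemma Ystar_eq {n k : ℕ} (x : Fin n → ℝ) (y : Fin k → ℝ) (v : ℝ) :
    Ystar x y v = pickedY y (kthLargest x 1) v := by
  unfold Ystar
  split_ifs with h
  · unfold pickedY
    have : Finset.univ.filter (fun j => kthLargest x 1 < y j) = ∅ := by
      rw [Finset.filter_eq_empty_iff]
      intro j _
      exact not_lt.2 (h j).le
    simp [this]
  · rfl

open Classical in
lemma picked_meas {k : ℕ} :
    Measurable (fun z : ℝ × (Fin k → ℝ) × ℝ => pickedY z.2.1 z.1 z.2.2) := by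
  have hS : ∀ S : Finset (Fin k), MeasurableSet
      {z : ℝ × (Fin k → ℝ) × ℝ | Finset.univ.filter (fun j => z.1 < z.2.1 j) = S} := by
    intro S
    have : {z : ℝ × (Fin k → ℝ) × ℝ | Finset.univ.filter (fun j => z.1 < z.2.1 j) = S} =
        ⋂ j : Fin k, {z | z.1 < z.2.1 j ↔ j ∈ S} := by
      ext z
      simp [Finset.ext_iff]
    rw [this]
    refine MeasurableSet.iInter fun j => ?_
    have hlt : MeasurableSet {z : ℝ × (Fin k → ℝ) × ℝ | z.1 < z.2.1 j} :=
      measurableSet_lt (by fun_prop) (by fun_prop)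
    exact hlt.iff (MeasurableSet.const _)
  have hf : ∀ (S : Finset (Fin k)), Measurable (fun z : ℝ × (Fin k → ℝ) × ℝ =>
      ((S.sort (· ≤ ·)).map z.2.1).getD (min (Int.toNat ⌊z.2.2 * S.card⌋) (S.card - 1)) 0) := by
    intro S
    have hi : Measurable (fun z : ℝ × (Fin k → ℝ) × ℝ =>
        min (Int.toNat ⌊z.2.2 * S.card⌋) (S.card - 1)) := by
      have : Measurable (fun z : ℝ × (Fin k → ℝ) × ℝ => ⌊z.2.2 * S.card⌋) :=
        Int.measurable_floor.comp (by fun_prop)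
      exact (measurable_from_top (f := fun a : ℤ => min (Int.toNat a) (S.card - 1))).comp this
    have hg : ∀ i : ℕ, Measurable (fun z : ℝ × (Fin k → ℝ) × ℝ =>
        ((S.sort (· ≤ ·)).map z.2.1).getD i 0) := by
      intro i
      by_cases h : i < (S.sort (· ≤ ·)).length
      · have : (fun z : ℝ × (Fin k → ℝ) × ℝ => ((S.sort (· ≤ ·)).map z.2.1).getD i 0) =
            fun z => z.2.1 ((S.sort (· ≤ ·))[i]) := by
          funext z
          rw [List.getD_eq_getElem _ _ (by simpa using h)]
          simp
        rw [this]
        fun_prop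
      · have : (fun z : ℝ × (Fin k → ℝ) × ℝ => ((S.sort (· ≤ ·)).map z.2.1).getD i 0) =
            fun z => 0 := by
          funext z
          rw [List.getD_eq_default _ _ (by simpa using h)]
        rw [this]
        fun_prop
    have := measurable_from_prod_countable_right
      (f := fun w : ℕ × (ℝ × (Fin k → ℝ) × ℝ) => ((S.sort (· ≤ ·)).map w.2.2.1).getD w.1 0) hg
    exact this.comp (hi.prodMk measurable_id)
  intro B hB
  have : (fun z : ℝ × (Fin k → ℝ) × ℝ => pickedY z.2.1 z.1 z.2.2) ⁻¹' B =
      ⋃ S : Finset (Fin k),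
        {z : ℝ × (Fin k → ℝ) × ℝ | Finset.univ.filter (fun j => z.1 < z.2.1 j) = S} ∩
        (fun z : ℝ × (Fin k → ℝ) × ℝ =>
          ((S.sort (· ≤ ·)).map z.2.1).getD (min (Int.toNat ⌊z.2.2 * S.card⌋) (S.card - 1)) 0) ⁻¹' B := by
    ext z
    simp only [Set.mem_iUnion, Set.mem_inter_iff, Set.mem_setOf_eq, exists_eq_left', Set.mem_preimage]
    rfl
  rw [this]
  exact MeasurableSet.iUnion fun S => (hS S).inter (hf S hB)

lemma main_aux (n k : ℕ) (hn : 1 ≤ n) (p : ℝ) (hp0 : 0 ≤ p) (hp1 : p ≤ 1) :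
    ((Measure.pi fun _ : Fin n => unif).prod ((Measure.pi fun _ : Fin (k + 1) => unif).prod unif))
      {ω : (Fin n → ℝ) × (Fin (k + 1) → ℝ) × ℝ |
          p < Ystar ω.1 ω.2.1 ω.2.2 ∧ kthLargest ω.1 1 < p} =
      ENNReal.ofReal ((n : ℝ) * (1 - p) *
        ∑ i ∈ Finset.range (k + 1), p ^ (n + i) / ((n : ℝ) + (i : ℝ))) := by
  set κ := (Measure.pi fun _ : Fin (k + 1) => unif).prod unif with hκ
  let B : Set (ℝ × (Fin (k + 1) → ℝ) × ℝ) := {z | p < pickedY z.2.1 z.1 z.2.2 ∧ z.1 < p}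
  have hB : MeasurableSet B :=
    (measurableSet_lt measurable_const picked_meas).inter
      (measurableSet_lt measurable_fst measurable_const)
  have hM := kth_meas hn
  have hset : {ω : (Fin n → ℝ) × (Fin (k + 1) → ℝ) × ℝ |
          p < Ystar ω.1 ω.2.1 ω.2.2 ∧ kthLargest ω.1 1 < p} =
      (Prod.map (fun x : Fin n → ℝ => kthLargest x 1) id) ⁻¹' B := by
    ext ω
    simp only [Ystar_eq]
    rfl
  have hG : Measurable (fun t => κ (Prod.mk t ⁻¹' B)) := measurable_measure_prodMk_left hB
  rw [hset, Measure.prod_apply ((hM.prodMap measurable_id) hB)]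
  have e1 := lintegral_map (μ := Measure.pi fun _ : Fin n => unif) hG hM
  have e2 : ∀ x : Fin n → ℝ, Prod.mk x ⁻¹' (Prod.map (fun x : Fin n → ℝ => kthLargest x 1) id ⁻¹' B)
      = Prod.mk (kthLargest x 1) ⁻¹' B := fun x => rfl
  simp_rw [e2]
  rw [← e1, max_law hn, lintegral_withDensity_eq_lintegral_mul _ (by fun_prop) hG]
  have hcalc : ∀ t ∈ Set.Ioc (0 : ℝ) 1,
      ((fun t : ℝ => ENNReal.ofReal (n * t ^ (n - 1))) * fun t => κ (Prod.mk t ⁻¹' B)) t =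
      (Set.Iio p).indicator (fun t => ∑ i ∈ Finset.range (k + 1),
        ENNReal.ofReal ((n * (1 - p)) * t ^ (n - 1 + i))) t := by
    intro t ht
    have ht0 := ht.1.le
    simp only [Pi.mul_apply]
    by_cases htp : t < p
    · rw [Set.indicator_of_mem (by exact htp)]
      have hs : Prod.mk t ⁻¹' B = {w : (Fin (k + 1) → ℝ) × ℝ | p < pickedY w.1 t w.2} := by
        ext w
        simp [B, htp]
      have hms : MeasurableSet {w : (Fin (k + 1) → ℝ) × ℝ | p < pickedY w.1 t w.2} := by
        rw [← hs]; exact measurable_prodMk_left hB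
      rw [hs, hκ, Measure.prod_apply hms]
      have e3 : ∀ y : Fin (k + 1) → ℝ, unif (Prod.mk y ⁻¹'
          {w : (Fin (k + 1) → ℝ) × ℝ | p < pickedY w.1 t w.2}) = cnt p y * (cnt t y)⁻¹ :=
        fun y => unif_picked y hp0 htp
      simp_rw [e3]
      have hp' : 0 ≤ 1 - p := by linarith
      rw [A_p ht0 htp hp1, ← ENNReal.ofReal_mul (by positivity),
        ← ENNReal.ofReal_sum_of_nonneg (fun i _ => by positivity)]
      congr 1
      rw [Finset.mul_sum, Finset.mul_sum]
      refine Finset.sum_congr rfl fun i _ => ?_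
      rw [pow_add]
      ring
    · rw [Set.indicator_of_notMem (by exact htp)]
      have hs : Prod.mk t ⁻¹' B = ∅ := by
        ext w
        simp [B, htp]
      simp [hs]
  rw [setLIntegral_congr_fun measurableSet_Ioc hcalc, lintegral_indicator measurableSet_Iio,
    Measure.restrict_restrict measurableSet_Iio]
  have hae : (Set.Iio p ∩ Set.Ioc 0 1 : Set ℝ) =ᵐ[volume] Set.Ioc 0 p := by
    have : (Set.Iio p ∩ Set.Ioc 0 1 : Set ℝ) = Set.Ioo 0 p := by
      ext t
      simp only [Set.mem_inter_iff, Set.mem_Iio, Set.mem_Ioc, Set.mem_Ioo]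
      constructor
      · tauto
      · rintro ⟨h, h'⟩; exact ⟨h', h, by linarith⟩
    rw [this]
    exact Ioo_ae_eq_Ioc
  rw [setLIntegral_congr hae, lintegral_finsetSum _ (fun i _ => by fun_prop)]
  have hp' : 0 ≤ 1 - p := by linarith
  simp_rw [lint_pow (n * (1 - p)) p (by positivity) hp0]
  rw [← ENNReal.ofReal_sum_of_nonneg (fun i _ => by positivity)]
  congr 1
  rw [Finset.mul_sum]
  refine Finset.sum_congr rfl fun i _ => ?_
  obtain ⟨l, rfl⟩ : ∃ l, n = l + 1 := ⟨n - 1, by omega⟩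
  simp only [Nat.add_sub_cancel]
  push_cast
  rw [show l + 1 + i = l + i + 1 by ring, show (l : ℝ) + 1 + i = l + i + 1 by ring]
  ring

/-- For integers `n ≥ 1` and `m ≥ 2`, and every `p ∈ [0,1]`:
`Pr[Y*_{n,m-1} > p ∧ X_{(1),n} < p] = n·(1-p)·Σ_{i=0}^{m-2} p^{n+i}/(n+i)`. -/
theorem stmt9 (n m : ℕ) (hn : 1 ≤ n) (hm : 2 ≤ m) :
    ∀ p ∈ Set.Icc (0 : ℝ) 1,
      (P₈ n m {ω : (Fin n → ℝ) × (Fin (m - 1) → ℝ) × ℝ |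
          p < Ystar ω.1 ω.2.1 ω.2.2 ∧ kthLargest ω.1 1 < p}).toReal =
      (n : ℝ) * (1 - p) * ∑ i ∈ Finset.range (m - 1), p ^ (n + i) / ((n : ℝ) + (i : ℝ)) := by
  intro p hp
  obtain ⟨k, rfl⟩ : ∃ k, m = k + 2 := ⟨m - 2, by omega⟩
  have hp' : 0 ≤ 1 - p := by linarith [hp.2]
  have hp0 := hp.1
  have h := main_aux n k hn p hp.1 hp.2
  have h2 := congrArg ENNReal.toReal h
  rw [ENNReal.toReal_ofReal (by positivity)] at h2
  exact h2
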